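/- Let 𝒜 be an abelian category. Then every self-CS-Rickart object of 𝒜 has SIP-extending, and every dual self-CS-Rickart object of 𝒜 has SSP-lifting. -/

import Mathlib

open CategoryTheory CategoryTheory.Limits

universe v u

variable {𝒜 : Type u} [Category.{v} 𝒜] [Abelian 𝒜]

/-- A monomorphism `e` is essential if whenever `e ≫ h` is a mono, `h` is a mono. -/
def IsEssentialMono {K L : 𝒜} (e : K ⟶ L) : Prop :=
  Mono e ∧ ∀ ⦃P : 𝒜⦄ (h : L ⟶ P), Mono (e ≫ h) → Mono h

/-- An epimorphism `t` is superfluous if whenever `h ≫ t` is an epi, `h` is an epi. -/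
def IsSuperfluousEpi {P C : 𝒜} (t : P ⟶ C) : Prop :=
  Epi t ∧ ∀ ⦃Q : 𝒜⦄ (h : Q ⟶ P), Epi (h ≫ t) → Epi h

/-- `N` is `M`-CS-Rickart: for every `f : M ⟶ N` the kernel morphism factors as an
essential monomorphism followed by a section. -/
def IsCSRickart (M N : 𝒜) : Prop :=
  ∀ f : M ⟶ N, ∃ (L : 𝒜) (e : kernel f ⟶ L) (s : L ⟶ M),
    IsEssentialMono e ∧ IsSplitMono s ∧ kernel.ι f = e ≫ s

/-- `N` is dual `M`-CS-Rickart: for every `f : M ⟶ N` the cokernel morphism factors as a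
retraction followed by a superfluous epimorphism. -/
def IsDualCSRickart (M N : 𝒜) : Prop :=
  ∀ f : M ⟶ N, ∃ (P : 𝒜) (r : N ⟶ P) (t : P ⟶ cokernel f),
    IsSplitEpi r ∧ IsSuperfluousEpi t ∧ cokernel.π f = r ≫ t

/-- `N` is `M`-Rickart: the kernel morphism of every `f : M ⟶ N` is a section. -/
def IsRickart (M N : 𝒜) : Prop := ∀ f : M ⟶ N, IsSplitMono (kernel.ι f)

/-- `N` is dual `M`-Rickart: the cokernel morphism of every `f : M ⟶ N` is a retraction. -/
def IsDualRickart (M N : 𝒜) : Prop := ∀ f : M ⟶ N, IsSplitEpi (cokernel.π f)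

/-- `N` is `M`-𝒦-nonsingular. -/
def IsKNonsingular (M N : 𝒜) : Prop :=
  ∀ f : M ⟶ N, IsEssentialMono (kernel.ι f) → f = 0

/-- `M` is `N`-𝒯-nonsingular. -/
def IsTNonsingular (M N : 𝒜) : Prop :=
  ∀ f : M ⟶ N, IsSuperfluousEpi (cokernel.π f) → f = 0

/-- `M'` is a direct summand of `M`: `M ≅ M' ⊕ M''` for some `M''`. -/
def IsDirectSummand (M' M : 𝒜) : Prop := ∃ M'' : 𝒜, Nonempty (M ≅ M' ⊞ M'')

/-- For subobjects `X ≤ D` of `M`: `X` is essential in `D`, i.e. every subobject of `D`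
meeting `X` trivially is zero. -/
def EssentialIn {M : 𝒜} (X D : Subobject M) : Prop :=
  X ≤ D ∧ ∀ Y : Subobject M, Y ≤ D → X ⊓ Y = ⊥ → Y = ⊥

/-- `X` is essential in a direct summand of `M`. -/
def EssentialInDirectSummand {M : 𝒜} (X : Subobject M) : Prop :=
  ∃ D : Subobject M, IsSplitMono D.arrow ∧ EssentialIn X D

/-- `M` has SIP-extending. -/
def SIPExtending (M : 𝒜) : Prop :=
  ∀ X₁ X₂ : Subobject M, EssentialInDirectSummand X₁ → EssentialInDirectSummand X₂ →
    EssentialInDirectSummand (X₁ ⊓ X₂)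

/-- `S` is a superfluous subobject of `Q`. -/
def SuperfluousIn {Q : 𝒜} (S : Subobject Q) : Prop :=
  ∀ Y : Subobject Q, S ⊔ Y = ⊤ → Y = ⊤

/-- `L` lies above a direct summand of `M`: there is a direct summand subobject `K ≤ L`
such that the image of `L` in `M/K` is superfluous in `M/K`. -/
def LiesAboveDirectSummand {M : 𝒜} (L : Subobject M) : Prop :=
  ∃ K : Subobject M, IsSplitMono K.arrow ∧ K ≤ L ∧
    SuperfluousIn (Subobject.mk (image.ι (L.arrow ≫ cokernel.π K.arrow)))

/-- `M` has SSP-lifting. -/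
def SSPLifting (M : 𝒜) : Prop :=
  ∀ L₁ L₂ : Subobject M, LiesAboveDirectSummand L₁ → LiesAboveDirectSummand L₂ →
    LiesAboveDirectSummand (L₁ ⊔ L₂)

/-- `M` is extending: every subobject of `M` is essential in a direct summand of `M`. -/
def Extending (M : 𝒜) : Prop := ∀ X : Subobject M, EssentialInDirectSummand X

section Lattice

variable {α : Type*} [Lattice α] [BoundedOrder α]

/-- The relation `EssentialIn` in an arbitrary bounded lattice. -/
def LatticeEssential (x d : α) : Prop :=
  x ≤ d ∧ ∀ y : α, y ≤ d → x ⊓ y = ⊥ → y = ⊥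

theorem LatticeEssential.trans {x d e : α} (h₁ : LatticeEssential x d)
    (h₂ : LatticeEssential d e) : LatticeEssential x e := by
  refine ⟨h₁.1.trans h₂.1, fun y hy hxy => h₂.2 y hy (h₁.2 _ inf_le_left ?_)⟩
  rw [← inf_assoc, inf_eq_left.2 h₁.1, hxy]

theorem LatticeEssential.inf {x₁ x₂ d₁ d₂ : α} (h₁ : LatticeEssential x₁ d₁)
    (h₂ : LatticeEssential x₂ d₂) : LatticeEssential (x₁ ⊓ x₂) (d₁ ⊓ d₂) := by
  refine ⟨inf_le_inf h₁.1 h₂.1, fun y hy hxy => h₂.2 y (hy.trans inf_le_right)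
    (h₁.2 _ (inf_le_right.trans (hy.trans inf_le_left)) ?_)⟩
  rw [← inf_assoc, hxy]

variable [IsModularLattice α]

theorem LatticeEssential.of_sup {a b c d : α} (hbc : IsCompl b c) (hab : a ≤ b)
    (h : LatticeEssential (a ⊔ c) d) : LatticeEssential a (d ⊓ b) := by
  refine ⟨le_inf (le_sup_left.trans h.1) hab, fun y hy hay =>
    h.2 y (hy.trans inf_le_left) ?_⟩
  have hb : (a ⊔ c) ⊓ b = a := by
    rw [sup_inf_assoc_of_le c hab, inf_comm c, hbc.inf_eq_bot, sup_bot_eq]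
  rw [← inf_eq_right.2 (hy.trans inf_le_right), ← inf_assoc, hb, hay]

theorem IsComplemented.inf_of_isCompl {b c d : α} (hd : IsComplemented d) (hbc : IsCompl b c)
    (hcd : c ≤ d) : IsComplemented (d ⊓ b) := by
  obtain ⟨e, he⟩ := hd
  refine ⟨c ⊔ e, Disjoint.isCompl_sup_right_of_isCompl_sup_left
    (hbc.disjoint.mono_left inf_le_right) ?_⟩
  rwa [inf_sup_assoc_of_le b hcd, hbc.sup_eq_top, inf_top_eq]

theorem exists_latticeEssential_inf
    (H : ∀ b c d : α, IsCompl b c → IsComplemented d →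
      ∃ e, IsComplemented e ∧ LatticeEssential ((b ⊓ d) ⊔ c) e)
    {x₁ x₂ d₁ d₂ : α} (hd₁ : IsComplemented d₁) (hd₂ : IsComplemented d₂)
    (h₁ : LatticeEssential x₁ d₁) (h₂ : LatticeEssential x₂ d₂) :
    ∃ d, IsComplemented d ∧ LatticeEssential (x₁ ⊓ x₂) d := by
  obtain ⟨c, hc⟩ := hd₁
  obtain ⟨e, he, hde⟩ := H d₁ c d₂ hc hd₂
  exact ⟨e ⊓ d₁, he.inf_of_isCompl hc (le_sup_right.trans hde.1),
    (h₁.inf h₂).trans (hde.of_sup hc inf_le_left)⟩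

end Lattice

namespace CategoryTheory.Subobject

theorem factors_of_epi_comp {M T P : 𝒜} {W : Subobject M} (q : T ⟶ P) [Epi q] (t : P ⟶ M)
    (h : W.Factors (q ≫ t)) : W.Factors t := by
  have h0 : t ≫ cokernel.π W.arrow = 0 := by
    rw [← cancel_epi q, ← Category.assoc, ← W.factorThru_arrow _ h, Category.assoc,
      cokernel.condition, comp_zero, comp_zero]
  rw [factors_iff]
  exact ⟨Abelian.monoLift W.arrow t h0, Abelian.monoLift_comp W.arrow t h0⟩

theorem eq_top_of_factors_id {C : Type*} [Category C] {M : C} {W : Subobject M} (h : W.Factors (𝟙 M)) : W = ⊤ :=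
  top_le_iff.1 <| le_of_factors <| by
    simpa using factors_of_factors_right (⊤ : Subobject M).arrow h

theorem le_pullback_iff {M N : 𝒜} (f : M ⟶ N) (X : Subobject M) (Y : Subobject N) :
    X ≤ (Subobject.pullback f).obj Y ↔ Y.Factors (X.arrow ≫ f) := by
  rw [← pullback_factors_iff]
  exact ⟨fun h => factors_of_le _ h X.factors_self, le_of_factors⟩

theorem le_kernelSubobject_iff {M N : 𝒜} (f : M ⟶ N) (X : Subobject M) :
    X ≤ kernelSubobject f ↔ X.arrow ≫ f = 0 := by
  rw [← kernelSubobject_factors_iff]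
  exact ⟨fun h => factors_of_le _ h X.factors_self, le_of_factors⟩

theorem eq_zero_of_kernelSubobject_eq_top {M N : 𝒜} {f : M ⟶ N} (h : ⊤ ≤ kernelSubobject f) :
    f = 0 := by
  rw [le_kernelSubobject_iff] at h
  rwa [← cancel_epi (⊤ : Subobject M).arrow, comp_zero]

theorem factors_sub {M T : 𝒜} {W : Subobject M} {f g : T ⟶ M} (hf : W.Factors f)
    (hg : W.Factors g) : W.Factors (f - g) := by
  refine factors_left_of_factors_add (f - g) g ?_ hg
  simpa using hf

instance isModularLattice (M : 𝒜) : IsModularLattice (Subobject M) where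
  sup_inf_le_assoc_of_le {x} y {z} hxz := by
    set d : (x : 𝒜) ⊞ (y : 𝒜) ⟶ M := biprod.desc x.arrow y.arrow with hd
    have hx : x ≤ imageSubobject d := le_of_factors <| by
      simpa [hd] using imageSubobject_factors_comp_self d biprod.inl
    have hy : y ≤ imageSubobject d := le_of_factors <| by
      simpa [hd] using imageSubobject_factors_comp_self d biprod.inr
    have ht : (imageSubobject d).Factors ((x ⊔ y) ⊓ z).arrow :=
      factors_of_le _ (le_trans (_root_.inf_le_left (a := x ⊔ y)) (sup_le hx hy)) (factors_self _)
    set q := pullback.fst ((imageSubobject d).factorThru _ ht) (factorThruImageSubobject d)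
    set p := pullback.snd ((imageSubobject d).factorThru _ ht) (factorThruImageSubobject d)
    have hqp : q ≫ ((x ⊔ y) ⊓ z).arrow =
        (p ≫ biprod.fst) ≫ x.arrow + (p ≫ biprod.snd) ≫ y.arrow := by
      calc q ≫ ((x ⊔ y) ⊓ z).arrow
          = (q ≫ (imageSubobject d).factorThru _ ht) ≫ (imageSubobject d).arrow := by
            rw [Category.assoc, factorThru_arrow]
        _ = p ≫ d := by
            rw [pullback.condition, Category.assoc, imageSubobject_arrow_comp]
        _ = _ := by
            rw [Category.assoc, Category.assoc, ← Preadditive.comp_add, ← biprod.desc_eq]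
    refine le_of_factors (factors_of_epi_comp q _ ?_)
    have hz : z.Factors ((p ≫ biprod.snd) ≫ y.arrow) := by
      refine factors_right_of_factors_add ((p ≫ biprod.fst) ≫ x.arrow) _ ?_
        (factors_of_le _ hxz (factors_comp_arrow _))
      rw [← hqp]
      exact factors_of_factors_right _ (factors_of_le _ (_root_.inf_le_right (a := x ⊔ y)) (factors_self _))
    rw [hqp]
    exact factors_add _ _ (sup_factors_of_factors_left (factors_comp_arrow _))
      (sup_factors_of_factors_right ((inf_factors _).2 ⟨factors_comp_arrow _, hz⟩))

theorem isCompl_mk_kernelSubobject {L M : 𝒜} (s : L ⟶ M) [Mono s] (r : M ⟶ L)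
    (hsr : s ≫ r = 𝟙 L) : IsCompl (Subobject.mk s) (kernelSubobject r) := by
  have hs {T : 𝒜} (t : T ⟶ L) : (Subobject.mk s).Factors (t ≫ s) :=
    factors_of_factors_right t (mk_factors_self s)
  refine ⟨disjoint_iff_inf_le.2 (le_of_factors ?_),
    codisjoint_iff.2 (eq_top_of_factors_id ?_)⟩
  · obtain ⟨⟨u, hu⟩, hk⟩ := (inf_factors _).1 (factors_self (Subobject.mk s ⊓ kernelSubobject r))
    replace ⟨u, hu⟩ : ∃ u : _ ⟶ L, u ≫ s = _ := ⟨u, hu⟩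
    rw [kernelSubobject_factors_iff, ← hu, Category.assoc, hsr, Category.comp_id] at hk
    rw [bot_factors_iff_zero, ← hu, hk, zero_comp]
  · have h : 𝟙 M = r ≫ s + (𝟙 M - r ≫ s) := by abel
    rw [h]
    refine factors_add _ _ (sup_factors_of_factors_left (hs r))
      (sup_factors_of_factors_right (kernelSubobject_factors _ _ ?_))
    simp [hsr]

theorem kernelSubobject_cokernel_le {M N : 𝒜} (f : M ⟶ N) :
    kernelSubobject (cokernel.π f) ≤ imageSubobject f := by
  have h0 : f ≫ cokernel.π (imageSubobject f).arrow = 0 := by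
    have h := factorThruImageSubobject f ≫= cokernel.condition (imageSubobject f).arrow
    rwa [← Category.assoc, imageSubobject_arrow_comp, comp_zero] at h
  have h1 : (kernelSubobject (cokernel.π f)).arrow ≫ cokernel.π (imageSubobject f).arrow = 0 := by
    rw [← cokernel.π_desc f _ h0, ← Category.assoc, kernelSubobject_arrow_comp, zero_comp]
  exact le_of_comm _ (Abelian.monoLift_comp (imageSubobject f).arrow _ h1)

/-- The two projections attached to a pair of complementary subobjects. -/
theorem exists_projections_of_isCompl {M : 𝒜} {D C : Subobject M} (h : IsCompl D C) :
    ∃ (r : M ⟶ D) (s : M ⟶ C), D.arrow ≫ r = 𝟙 _ ∧ C.arrow ≫ s = 𝟙 _ ∧ C.arrow ≫ r = 0 ∧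
      D.arrow ≫ s = 0 ∧ r ≫ D.arrow + s ≫ C.arrow = 𝟙 M := by
  set d : (D : 𝒜) ⊞ (C : 𝒜) ⟶ M := biprod.desc D.arrow C.arrow with hd
  have hmono : Mono d := by
    refine Preadditive.mono_of_cancel_zero _ fun g hg => ?_
    have hg' : (g ≫ biprod.fst) ≫ D.arrow = -((g ≫ biprod.snd) ≫ C.arrow) := by
      rw [eq_neg_iff_add_eq_zero, Category.assoc, Category.assoc, ← Preadditive.comp_add,
        ← biprod.desc_eq, hg]
    have h0 : (g ≫ biprod.fst) ≫ D.arrow = 0 := by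
      rw [← bot_factors_iff_zero, ← h.inf_eq_bot, inf_factors]
      refine ⟨factors_comp_arrow _, ?_⟩
      rw [hg', ← Preadditive.neg_comp]
      exact factors_comp_arrow _
    have h1 : (g ≫ biprod.snd) ≫ C.arrow = 0 := by
      rw [h0] at hg'
      exact neg_eq_zero.1 hg'.symm
    refine biprod.hom_ext _ _ ?_ ?_
    · rw [← cancel_mono D.arrow, h0, zero_comp, zero_comp]
    · rw [← cancel_mono C.arrow, h1, zero_comp, zero_comp]
  have hepi : Epi d := by
    refine Preadditive.epi_of_cancel_zero _ fun g hg => eq_zero_of_kernelSubobject_eq_top ?_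
    rw [← h.sup_eq_top]
    refine sup_le ((le_kernelSubobject_iff _ _).2 ?_) ((le_kernelSubobject_iff _ _).2 ?_)
    · simpa [hd] using biprod.inl ≫= hg
    · simpa [hd] using biprod.inr ≫= hg
  have : IsIso d := isIso_of_mono_of_epi d
  have hD : D.arrow ≫ inv d = biprod.inl := by rw [IsIso.comp_inv_eq, hd, biprod.inl_desc]
  have hC : C.arrow ≫ inv d = biprod.inr := by rw [IsIso.comp_inv_eq, hd, biprod.inr_desc]
  refine ⟨inv d ≫ biprod.fst, inv d ≫ biprod.snd, ?_, ?_, ?_, ?_, ?_⟩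
  · rw [reassoc_of% hD, biprod.inl_fst]
  · rw [reassoc_of% hC, biprod.inr_snd]
  · rw [reassoc_of% hC, biprod.inr_fst]
  · rw [reassoc_of% hD, biprod.inl_snd]
  · rw [Category.assoc, Category.assoc, ← Preadditive.comp_add, ← biprod.desc_eq,
      IsIso.inv_hom_id]

theorem isSplitMono_arrow_iff {M : 𝒜} (D : Subobject M) :
    IsSplitMono D.arrow ↔ IsComplemented D := by
  refine ⟨fun _ => ⟨_, D.mk_arrow ▸ isCompl_mk_kernelSubobject D.arrow _ (IsSplitMono.id D.arrow)⟩, ?_⟩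
  rintro ⟨C, h⟩
  obtain ⟨r, -, hr, -⟩ := exists_projections_of_isCompl h
  exact ⟨⟨⟨r, hr⟩⟩⟩

theorem exists_kernelSubobject_eq {M : 𝒜} {D C E : Subobject M} (h : IsCompl D C)
    (hE : IsComplemented E) : ∃ f : M ⟶ M, kernelSubobject f = (D ⊓ E) ⊔ C := by
  obtain ⟨F, hEF⟩ := hE
  obtain ⟨r, s, hDr, -, hCr, -, hrs⟩ := exists_projections_of_isCompl h
  obtain ⟨r', s', -, -, -, hEs, hrs'⟩ := exists_projections_of_isCompl hEF
  set f : M ⟶ M := r ≫ D.arrow ≫ s' ≫ F.arrow with hf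
  refine ⟨f, le_antisymm (le_of_factors ?_) (sup_le ?_ ?_)⟩
  · set t := (kernelSubobject f).arrow
    have ht : t ≫ r ≫ D.arrow ≫ s' ≫ F.arrow = 0 := kernelSubobject_arrow_comp f
    have h1 : t = (t ≫ r) ≫ D.arrow + (t ≫ s) ≫ C.arrow := by
      rw [Category.assoc, Category.assoc, ← Preadditive.comp_add, hrs, Category.comp_id]
    rw [h1]
    refine factors_add _ _ (sup_factors_of_factors_left ((inf_factors _).2
      ⟨factors_comp_arrow _, ?_⟩)) (sup_factors_of_factors_right (factors_comp_arrow _))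
    have h2 : (t ≫ r) ≫ D.arrow = (t ≫ r ≫ D.arrow ≫ r') ≫ E.arrow := by
      have := congrArg (fun k => (t ≫ r ≫ D.arrow) ≫ k) hrs'
      simpa [ht] using this.symm
    rw [h2]
    exact factors_comp_arrow _
  · obtain ⟨hD, hE⟩ := (inf_factors _).1 (factors_self (D ⊓ E))
    rw [le_kernelSubobject_iff, hf, ← D.factorThru_arrow _ hD, Category.assoc, reassoc_of% hDr,
      ← Category.assoc, D.factorThru_arrow, ← E.factorThru_arrow _ hE, Category.assoc,
      reassoc_of% hEs, zero_comp, comp_zero]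
  · rw [le_kernelSubobject_iff, hf, reassoc_of% hCr, zero_comp]

theorem exists_imageSubobject_eq {M : 𝒜} {D C E : Subobject M} (h : IsCompl D C)
    (hE : IsComplemented E) : ∃ f : M ⟶ M, imageSubobject f = (D ⊔ E) ⊓ C := by
  obtain ⟨F, hEF⟩ := hE
  obtain ⟨r, s, -, hCs, -, hDs, hrs⟩ := exists_projections_of_isCompl h
  obtain ⟨r', -, hEr, -⟩ := exists_projections_of_isCompl hEF
  set f : M ⟶ M := r' ≫ E.arrow ≫ s ≫ C.arrow with hf
  refine ⟨f, le_antisymm ?_ (le_of_factors ?_)⟩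
  · have hfac : ((D ⊔ E) ⊓ C).Factors f := by
      rw [inf_factors]
      constructor
      · have h1 : f = r' ≫ E.arrow - (r' ≫ E.arrow ≫ r) ≫ D.arrow := by
          rw [eq_sub_iff_add_eq']
          have := congrArg (fun k => (r' ≫ E.arrow) ≫ k) hrs
          simpa [hf] using this
        rw [h1]
        exact factors_sub (sup_factors_of_factors_right (factors_comp_arrow _))
          (sup_factors_of_factors_left (factors_comp_arrow _))
      · simpa [hf] using factors_comp_arrow (P := C) (r' ≫ E.arrow ≫ s)
    exact imageSubobject_le f _ (factorThru_arrow _ f hfac)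
  · have hle : D ⊔ E ≤ (Subobject.pullback (s ≫ C.arrow)).obj (imageSubobject f) := by
      refine sup_le ((le_pullback_iff _ _ _).2 ?_) ((le_pullback_iff _ _ _).2 ?_)
      · rw [reassoc_of% hDs, zero_comp]
        exact factors_zero
      · have h1 : E.arrow ≫ s ≫ C.arrow = E.arrow ≫ f := by rw [hf, reassoc_of% hEr]
        rw [h1]
        exact imageSubobject_factors_comp_self _ _
    obtain ⟨hDE, hC⟩ := (inf_factors _).1 (factors_self ((D ⊔ E) ⊓ C))
    have h2 := (pullback_factors_iff _ _ _).1 (factors_of_le _ hle hDE)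
    rwa [← C.factorThru_arrow _ hC, Category.assoc, reassoc_of% hCs, C.factorThru_arrow] at h2

theorem eq_top_of_epi_arrow_comp {M Q : 𝒜} (r : M ⟶ Q) [Epi r] {Y : Subobject M}
    (hr : kernelSubobject r ≤ Y) (h : Epi (Y.arrow ≫ r)) : Y = ⊤ := by
  have h0 : kernel.ι r ≫ cokernel.π Y.arrow = 0 := by
    have hf : Y.Factors (kernel.ι r) :=
      factors_of_le _ hr (kernelSubobject_factors _ _ (kernel.condition r))
    rw [← Y.factorThru_arrow _ hf, Category.assoc, cokernel.condition, comp_zero]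
  have h1 : r ≫ Abelian.epiDesc r _ h0 = cokernel.π Y.arrow := Abelian.comp_epiDesc _ _ _
  have h2 : Abelian.epiDesc r _ h0 = 0 := by
    rw [← cancel_epi (Y.arrow ≫ r), Category.assoc, h1, cokernel.condition, comp_zero]
  have h3 : cokernel.π Y.arrow = 0 := by rw [← h1, h2, comp_zero]
  have : Epi Y.arrow := Preadditive.epi_of_cokernel_zero h3
  have : IsIso Y.arrow := isIso_of_mono_of_epi _
  exact eq_top_of_isIso_arrow Y

end CategoryTheory.Subobject

open CategoryTheory.Subobject

theorem IsEssentialMono.eq_zero {K L T : 𝒜} {e : K ⟶ L} (he : IsEssentialMono e) (y : T ⟶ L)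
    [Mono y] (h : ∀ ⦃S : 𝒜⦄ (a : S ⟶ K) (b : S ⟶ T), a ≫ e = b ≫ y → a ≫ e = 0) : y = 0 := by
  have := he.1
  have hm : Mono (cokernel.π y) := by
    refine he.2 _ (Preadditive.mono_of_cancel_zero _ fun a ha => ?_)
    rw [← Category.assoc] at ha
    rw [← cancel_mono e, zero_comp]
    exact h a (Abelian.monoLift y _ ha) (Abelian.monoLift_comp _ _ _).symm
  rw [← cancel_mono (cokernel.π y), cokernel.condition, zero_comp]

theorem IsCSRickart.exists_latticeEssential {M : 𝒜} (h : IsCSRickart M M) (f : M ⟶ M) :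
    ∃ D : Subobject M, IsComplemented D ∧ LatticeEssential (kernelSubobject f) D := by
  obtain ⟨L, e, s, he, hs, hes⟩ := h f
  refine ⟨Subobject.mk s, ⟨_, isCompl_mk_kernelSubobject s _ (IsSplitMono.id s)⟩, ?_,
    fun Y hY hfY => ?_⟩
  · exact Subobject.mk_le_mk_of_comm e hes.symm
  · have hYs : Subobject.ofLEMk Y s hY ≫ s = Y.arrow := Subobject.ofLEMk_comp hY
    have h0 : Subobject.ofLEMk Y s hY = 0 := by
      refine he.eq_zero _ fun S a b hab => ?_
      rw [← cancel_mono s, zero_comp, ← bot_factors_iff_zero, ← hfY, inf_factors]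
      constructor
      · rw [Category.assoc, ← hes]
        exact kernelSubobject_factors _ _ (by simp)
      · rw [hab, Category.assoc, hYs]
        exact factors_comp_arrow _
    refine le_bot_iff.1 (le_of_factors ?_)
    rw [bot_factors_iff_zero, ← hYs, h0, zero_comp]

theorem IsDualCSRickart.exists_latticeEssential {M : 𝒜} (h : IsDualCSRickart M M) (f : M ⟶ M) :
    ∃ K : Subobject M, IsComplemented K ∧
      LatticeEssential (OrderDual.toDual (imageSubobject f)) (OrderDual.toDual K) := by
  obtain ⟨P, r, t, hr, ht, hrt⟩ := h f
  refine ⟨kernelSubobject r, ⟨_, (isCompl_mk_kernelSubobject _ r (IsSplitEpi.id r)).symm⟩, ?_,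
    fun Y hY hfY => ?_⟩
  · change kernelSubobject r ≤ imageSubobject f
    refine le_trans ?_ (kernelSubobject_cokernel_le f)
    rw [le_kernelSubobject_iff, hrt, ← Category.assoc, kernelSubobject_arrow_comp, zero_comp]
  · change Subobject M at Y
    refine eq_top_of_epi_arrow_comp r hY (ht.2 _ ?_)
    rw [Category.assoc, ← hrt]
    refine Preadditive.epi_of_cancel_zero _ fun g hg => ?_
    have h0 : cokernel.π f ≫ g = 0 := by
      refine eq_zero_of_kernelSubobject_eq_top ?_
      rw [← (show imageSubobject f ⊔ Y = ⊤ from hfY)]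
      refine sup_le (imageSubobject_le f
        (factorThruKernelSubobject _ f (by simp)) (by simp)) ?_
      rw [le_kernelSubobject_iff, ← Category.assoc, hg]
    rw [← cancel_epi (cokernel.π f), h0, comp_zero]

theorem superfluousIn_iff {M : 𝒜} {K L : Subobject M} :
    SuperfluousIn (Subobject.mk (image.ι (L.arrow ≫ cokernel.π K.arrow))) ↔
      ∀ Y : Subobject M, K ≤ Y → L ⊔ Y = ⊤ → Y = ⊤ := by
  set p := cokernel.π K.arrow with hp
  change SuperfluousIn (imageSubobject (L.arrow ≫ p)) ↔ _
  have hker : kernelSubobject p ≤ K :=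
    le_of_comm _ (Abelian.monoLift_comp K.arrow _ (kernelSubobject_arrow_comp p))
  have hL : (imageSubobject (L.arrow ≫ p)).Factors (L.arrow ≫ p) := by
    simpa using imageSubobject_factors_comp_self (L.arrow ≫ p) (𝟙 _)
  constructor
  · intro h Y hKY hLY
    have hY : (imageSubobject (Y.arrow ≫ p)).Factors (Y.arrow ≫ p) := by
      simpa using imageSubobject_factors_comp_self (Y.arrow ≫ p) (𝟙 _)
    refine eq_top_of_epi_arrow_comp p (hker.trans hKY) ?_
    have htop : imageSubobject (Y.arrow ≫ p) = ⊤ := by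
      refine h _ (eq_top_of_factors_id (factors_of_epi_comp p _ ?_))
      rw [Category.comp_id]
      have hle : L ⊔ Y ≤ (Subobject.pullback p).obj
          (imageSubobject (L.arrow ≫ p) ⊔ imageSubobject (Y.arrow ≫ p)) :=
        sup_le ((le_pullback_iff _ _ _).2 (sup_factors_of_factors_left hL))
          ((le_pullback_iff _ _ _).2 (sup_factors_of_factors_right hY))
      rw [hLY] at hle
      have := (pullback_factors_iff _ _ _).1 (factors_of_le _ hle (top_factors (𝟙 M)))
      simpa using this
    have : IsIso (imageSubobject (Y.arrow ≫ p)).arrow := (isIso_arrow_iff_eq_top _).2 htop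
    rw [← imageSubobject_arrow_comp (Y.arrow ≫ p)]
    exact epi_comp _ _
  · intro h Z hZ
    set Y := (Subobject.pullback p).obj Z with hY
    have hYZ : Z.Factors (Y.arrow ≫ p) := (le_pullback_iff p Y Z).1 le_rfl
    have hKY : K ≤ Y := (le_pullback_iff p K Z).2 <| by
      rw [hp, cokernel.condition]
      exact factors_zero
    have hYtop : Y = ⊤ := by
      refine h Y hKY (eq_top_of_epi_arrow_comp p (hker.trans (hKY.trans le_sup_right)) ?_)
      refine Preadditive.epi_of_cancel_zero _ fun g hg => eq_zero_of_kernelSubobject_eq_top ?_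
      have hg' {T : 𝒜} (t : T ⟶ M) (ht : (L ⊔ Y).Factors t) : t ≫ p ≫ g = 0 := by
        rw [← factorThru_arrow _ t ht, Category.assoc, ← Category.assoc _ p, hg, comp_zero]
      rw [← hZ]
      refine sup_le ?_ ((le_kernelSubobject_iff _ _).2 ?_)
      · have hLg : (L.arrow ≫ p) ≫ g = 0 := by
          rw [Category.assoc, hg' _ (sup_factors_of_factors_left (factors_self L))]
        exact imageSubobject_le _ (factorThruKernelSubobject g _ hLg) (by simp)
      · have hYs : Y.Factors (pullback.snd Z.arrow p) := by
          rw [hY, pullback_factors_iff, ← pullback.condition]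
          exact factors_comp_arrow _
        rw [← cancel_epi (pullback.fst Z.arrow p), ← Category.assoc, pullback.condition,
          Category.assoc, hg' _ (sup_factors_of_factors_right hYs), comp_zero]
    rw [hYtop] at hYZ
    have := factors_of_epi_comp (⊤ : Subobject M).arrow _ hYZ
    exact eq_top_of_factors_id (factors_of_epi_comp p _ (by simpa using this))

theorem liesAboveDirectSummand_iff {M : 𝒜} (L : Subobject M) :
    LiesAboveDirectSummand L ↔ ∃ K : (Subobject M)ᵒᵈ, IsComplemented K ∧
      LatticeEssential (OrderDual.toDual L) K := by
  constructor
  · rintro ⟨K, hK, hKL, hs⟩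
    obtain ⟨C, hC⟩ := (isSplitMono_arrow_iff K).1 hK
    exact ⟨OrderDual.toDual K, ⟨OrderDual.toDual C, hC.dual⟩, hKL, (superfluousIn_iff).1 hs⟩
  · rintro ⟨K, ⟨C, hC⟩, hKL, hs⟩
    exact ⟨OrderDual.ofDual K, (isSplitMono_arrow_iff _).2 ⟨OrderDual.ofDual C, hC.ofDual⟩, hKL,
      (superfluousIn_iff).2 hs⟩

theorem IsCSRickart.sipExtending {M : 𝒜} (h : IsCSRickart M M) : SIPExtending M := by
  rintro X₁ X₂ ⟨D₁, hD₁, h₁⟩ ⟨D₂, hD₂, h₂⟩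
  rw [isSplitMono_arrow_iff] at hD₁ hD₂
  obtain ⟨D, hD, hX⟩ := exists_latticeEssential_inf (fun b c d hbc hd => by
    obtain ⟨f, hf⟩ := exists_kernelSubobject_eq hbc hd
    exact hf ▸ h.exists_latticeEssential f) hD₁ hD₂ h₁ h₂
  exact ⟨D, (isSplitMono_arrow_iff D).2 hD, hX⟩

theorem IsDualCSRickart.sspLifting {M : 𝒜} (h : IsDualCSRickart M M) : SSPLifting M := by
  intro L₁ L₂ h₁ h₂
  rw [liesAboveDirectSummand_iff] at h₁ h₂ ⊢
  obtain ⟨K₁, hK₁, h₁⟩ := h₁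
  obtain ⟨K₂, hK₂, h₂⟩ := h₂
  refine exists_latticeEssential_inf (fun b c d hbc hd => ?_) hK₁ hK₂ h₁ h₂
  obtain ⟨e, he⟩ := hd
  obtain ⟨f, hf⟩ := exists_imageSubobject_eq hbc.ofDual ⟨_, he.ofDual⟩
  obtain ⟨K, ⟨C, hC⟩, hfK⟩ := h.exists_latticeEssential f
  rw [hf] at hfK
  exact ⟨OrderDual.toDual K, ⟨OrderDual.toDual C, hC.dual⟩, hfK⟩

/-- Every self-CS-Rickart object has SIP-extending, and every dual
self-CS-Rickart object has SSP-lifting. -/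
theorem stmt10 :
    (∀ M : 𝒜, IsCSRickart M M → SIPExtending M) ∧
      (∀ M : 𝒜, IsDualCSRickart M M → SSPLifting M) := by
  exact ⟨fun _ h => h.sipExtending, fun _ h => h.sspLifting⟩
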